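/- Let S be a totally ordered idempotent semifield and let p ∈ S^{C(E,d)} and q ∈ S^{C(E,e)} be tropical Plücker vectors (valuated matroids) on a finite ground set E, of ranks d and e respectively. Define (p ∧ q)_I = Σ_{A ⊔ B = I} p_A q_B for I of size d+e, where the sum ranges over partitions of I into disjoint sets A of size d and B of size e. If at least one coordinate of p ∧ q is nonzero, then p ∧ q is a tropical Plücker vector of rank d+e: for all A of size d+e+1 and B of size d+e−1, the sum Σ_{i ∈ A∖B} (p∧q)_{A∖{i}} (p∧q)_{B∪{i}} tropically vanishes (the maximum is attained at least twice or the sum is zero). -/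

import Mathlib

/-! STATEMENT 10: Stable sum of tropical Plücker vectors.  Over a totally
ordered idempotent semifield `S`, if `p` and `q` are tropical Plücker vectors
(valuated matroids) of ranks `d` and `e` on a finite ground set, and the
stable sum `(p ∧ q)_I = Σ_{A ⊔ B = I, |A| = d} p_A q_B` has at least one
nonzero coordinate, then `p ∧ q` is a tropical Plücker vector of rank `d+e`. -/

noncomputable section

local instance tropOrderBot {S : Type*} [LinearOrderedCommGroupWithZero S] :
    OrderBot S where
  bot := 0
  bot_le _ := zero_le'

variable {S : Type*} [LinearOrderedCommGroupWithZero S] {E : Type*}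
  [Fintype E] [DecidableEq E]

/-- A tropical sum over a finite index set tropically vanishes if its value is
unchanged upon deleting any single term. -/
def TropVanishes {ι : Type*} [DecidableEq ι] (T : Finset ι) (g : ι → S) : Prop :=
  ∀ j ∈ T, (T.erase j).sup g = T.sup g

/-- `p` is a tropical Plücker vector (valuated matroid) of rank `d` on `E`:
it is nonzero, supported on `d`-element subsets, and satisfies the tropical
Plücker relations. -/
def IsTropPlucker (d : ℕ) (p : Finset E → S) : Prop :=
  (∃ A, p A ≠ 0) ∧ (∀ A, p A ≠ 0 → A.card = d) ∧
    ∀ A B : Finset E, A.card = d + 1 → B.card = d - 1 →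
      TropVanishes (A \ B) fun i => p (A.erase i) * p (insert i B)

/-- The stable sum `p ∧ q`. -/
def stableSum (d : ℕ) (p q : Finset E → S) : Finset E → S :=
  fun I => (I.powerset.filter fun A => A.card = d).sup fun A => p A * q (I \ A)

/-- Exchange property of valuated matroids. -/
def ExchProp {V : Type*} [DecidableEq V] (r : Finset V → S) : Prop :=
  ∀ X Y : Finset V, ∀ i ∈ X, i ∉ Y → r X * r Y ≠ 0 →
    ∃ j ∈ Y, j ∉ X ∧ r X * r Y ≤ r (insert j (X.erase i)) * r (insert i (Y.erase j))

theorem exch_of_plucker {d : ℕ} {p : Finset E → S} (hp : IsTropPlucker d p) : ExchProp p := by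
  obtain ⟨-, hc, hv⟩ := hp
  intro X Y i hiX hiY hne
  have hX := hc X (left_ne_zero_of_mul hne)
  have hY := hc Y (right_ne_zero_of_mul hne)
  have h := hv (insert i Y) (X.erase i) (by rw [Finset.card_insert_of_notMem hiY, hY])
    (by rw [Finset.card_erase_of_mem hiX, hX]) i (by simp)
  have h1 : p X * p Y ≤ (insert i Y \ X.erase i).sup
      (fun k => p ((insert i Y).erase k) * p (insert k (X.erase i))) := by
    refine le_trans (le_of_eq ?_) (Finset.le_sup (b := i) (by simp))
    simp only [Finset.erase_insert hiY, Finset.insert_erase hiX]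
    exact mul_comm _ _
  rw [← h] at h1
  rcases Finset.eq_empty_or_nonempty ((insert i Y \ X.erase i).erase i) with he | hn
  · rw [he, Finset.sup_empty] at h1
    exact absurd (le_antisymm h1 zero_le') hne
  · obtain ⟨j, hj, hj2⟩ := Finset.exists_mem_eq_sup _ hn
      (fun k => p ((insert i Y).erase k) * p (insert k (X.erase i)))
    rw [hj2] at h1
    simp only [Finset.mem_erase, Finset.mem_sdiff, Finset.mem_insert] at hj
    refine ⟨j, by tauto, by tauto, ?_⟩
    rw [mul_comm (p (insert j _))]
    rwa [Finset.erase_insert_of_ne (Ne.symm hj.1)] at h1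

theorem vanishes_of_exch {p : Finset E → S} (hp : ExchProp p) (A B : Finset E) :
    TropVanishes (A \ B) fun i => p (A.erase i) * p (insert i B) := by
  intro i hi
  simp only [Finset.mem_sdiff] at hi
  refine le_antisymm (Finset.sup_mono (Finset.erase_subset _ _)) (Finset.sup_le ?_)
  intro k hk
  by_cases hki : k = i
  · subst hki
    by_cases h0 : p (insert k B) * p (A.erase k) = 0
    · rw [mul_comm, h0]; exact zero_le'
    · obtain ⟨j, hj, hj2, hle⟩ := hp (insert k B) (A.erase k) k (by simp) (by simp) h0
      rw [mul_comm]
      refine hle.trans ?_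
      simp only [Finset.mem_erase, Finset.mem_insert, not_or] at hj hj2
      refine le_trans (le_of_eq ?_) (Finset.le_sup (b := j) (by simp; tauto))
      have e1 : insert j ((insert k B).erase k) = insert j B := by
        rw [Finset.erase_insert hi.2]
      have e2 : insert k ((A.erase k).erase j) = A.erase j := by
        ext z; simp only [Finset.mem_insert, Finset.mem_erase]; grind
      simp only [e1, e2]
      exact mul_comm _ _
  · exact Finset.le_sup (f := fun i => p (A.erase i) * p (insert i B)) (by simp_all)

/-- Merging the element `y` into `x`. -/
def mergeVec {V : Type*} [DecidableEq V] (x y : V) (r : Finset V → S) : Finset V → S :=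
  fun J => if y ∈ J then 0 else
    if x ∈ J then max (r J) (r (insert y (J.erase x))) else r J

section merge

variable {V : Type*} [DecidableEq V] {x y : V} {r : Finset V → S}

theorem merge_F1 (J J' : Finset V) (h : y ∉ J) (e : J' = J) : r J' ≤ mergeVec x y r J := by
  subst e
  unfold mergeVec
  rw [if_neg h]
  split_ifs
  · exact le_max_left _ _
  · exact le_rfl

theorem merge_F2 (J J' : Finset V) (h : y ∉ J) (hx : x ∈ J) (e : J' = insert y (J.erase x)) :
    r J' ≤ mergeVec x y r J := by
  subst e
  unfold mergeVec
  rw [if_neg h, if_pos hx]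
  exact le_max_right _ _

theorem merge_F3 (J : Finset V) (h : mergeVec x y r J ≠ 0) : y ∉ J := by
  intro hy
  apply h
  unfold mergeVec
  rw [if_pos hy]

theorem merge_F4 (J : Finset V) (h : y ∉ J) : mergeVec x y r J = r J ∨
    (x ∈ J ∧ mergeVec x y r J = r (insert y (J.erase x))) := by
  unfold mergeVec
  rw [if_neg h]
  split_ifs with hx
  · rcases max_choice (r J) (r (insert y (J.erase x))) with h | h
    · exact Or.inl h
    · exact Or.inr ⟨hx, h⟩
  · exact Or.inl rfl

theorem merge_caseA (hr : ExchProp r) {X Y : Finset V} {i : V} (hiX : i ∈ X) (hiY : i ∉ Y)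
    (hyX : y ∉ X) (hyY : y ∉ Y) (hne : mergeVec x y r X * mergeVec x y r Y ≠ 0)
    (hX : mergeVec x y r X = r X) (hY : mergeVec x y r Y = r Y) :
    ∃ j ∈ Y, j ∉ X ∧ mergeVec x y r X * mergeVec x y r Y ≤
      mergeVec x y r (insert j (X.erase i)) * mergeVec x y r (insert i (Y.erase j)) := by
  rw [hX, hY] at hne ⊢
  obtain ⟨j, hj, hj', hle⟩ := hr X Y i hiX hiY hne
  refine ⟨j, hj, hj', hle.trans (mul_le_mul' (merge_F1 _ _ ?_ rfl) (merge_F1 _ _ ?_ rfl))⟩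
  · clear hle; grind
  · clear hle; grind

theorem exch_merge (hxy : x ≠ y) (hr : ExchProp r) : ExchProp (mergeVec x y r) := by
  intro X Y i hiX hiY hne
  have hyX := merge_F3 X (left_ne_zero_of_mul hne)
  have hyY := merge_F3 Y (right_ne_zero_of_mul hne)
  have hiy : i ≠ y := fun h => hyX (h ▸ hiX)
  rcases merge_F4 (x := x) (r := r) X hyX with hX | ⟨hxX, hX⟩ <;> rcases merge_F4 (x := x) (r := r) Y hyY with hY | ⟨hxY, hY⟩
  · exact merge_caseA hr hiX hiY hyX hyY hne hX hY
  · -- case D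
    by_cases hxX : x ∈ X
    · have hix : i ≠ x := fun h => hiY (h ▸ hxY)
      have hne' := hne
      rw [hX, hY] at hne'
      obtain ⟨j, hj, hj', hle⟩ := hr X _ i hiX (by grind) hne'
      by_cases hjy : j = y
      · subst hjy
        obtain ⟨k, hk, hk', hle2⟩ := hr (insert j (X.erase i))
          (insert i ((insert j (Y.erase x)).erase j)) x (by grind) (by grind)
          (fun h => hne' (le_antisymm (hle.trans h.le) zero_le'))
        have hle3 := hle.trans hle2
        by_cases hki : k = i
        · subst hki
          have e1 : insert k ((insert j (X.erase k)).erase x) = insert j (X.erase x) := by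
            ext z; grind
          have e2 : insert x ((insert k ((insert j (Y.erase x)).erase j)).erase k) = Y := by
            ext z; grind
          rw [e1, e2, ← hX, ← hY] at hle3
          have g1 := merge_F2 (x := x) (y := j) (r := r) X _ hyX hxX rfl
          have g2 := merge_F1 (x := x) (y := j) (r := r) Y _ hyY rfl
          refine merge_caseA hr hiX hiY hyX hyY hne hX (le_antisymm ?_ g2)
          have h5 := hle3.trans (mul_le_mul_left g1 (r Y))
          exact le_of_mul_le_mul_left h5 (zero_lt_iff.2 (left_ne_zero_of_mul hne))
        · refine ⟨k, by grind, by grind, ?_⟩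
          rw [hX, hY]
          refine hle3.trans (mul_le_mul' (merge_F2 _ _ ?_ ?_ ?_) (merge_F1 _ _ ?_ ?_))
          · grind
          · grind
          · ext z; grind
          · grind
          · ext z; grind
      · refine ⟨j, by grind, by grind, ?_⟩
        rw [hX, hY]
        refine hle.trans (mul_le_mul' (merge_F1 _ _ ?_ ?_) (merge_F2 _ _ ?_ ?_ ?_))
        · grind
        · rfl
        · grind
        · grind
        · ext z; grind
    · have hix : i ≠ x := fun h => hxX (h ▸ hiX)
      rw [hX, hY] at hne ⊢
      obtain ⟨j, hj, hj', hle⟩ := hr X _ i hiX (by grind) hne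
      by_cases hjy : j = y
      · subst hjy
        refine ⟨x, hxY, hxX, hle.trans (mul_le_mul' (merge_F2 _ _ ?_ ?_ ?_) (merge_F1 _ _ ?_ ?_))⟩
        · grind
        · grind
        · ext z; grind
        · grind
        · ext z; grind
      · refine ⟨j, by grind, by grind, hle.trans (mul_le_mul' (merge_F1 _ _ ?_ rfl) (merge_F2 _ _ ?_ ?_ ?_))⟩
        · grind
        · grind
        · grind
        · ext z; grind
  · -- case C
    by_cases hxY : x ∈ Y
    · have hix : i ≠ x := fun h => hiY (h ▸ hxY)
      have hne' := hne
      rw [hX, hY] at hne'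
      obtain ⟨j, hj, hj', hle⟩ := hr _ Y i (by grind) hiY hne'
      by_cases hjx : j = x
      · subst hjx
        obtain ⟨k, hk, hk', hle2⟩ := hr (insert j ((insert y (X.erase j)).erase i))
          (insert i (Y.erase j)) y (by grind) (by grind)
          (fun h => hne' (le_antisymm (hle.trans h.le) zero_le'))
        have hle3 := hle.trans hle2
        by_cases hki : k = i
        · subst hki
          have e1 : insert k ((insert j ((insert y (X.erase j)).erase k)).erase y) = X := by
            ext z; grind
          have e2 : insert y ((insert k (Y.erase j)).erase k) = insert y (Y.erase j) := by
            ext z; grind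
          rw [e1, e2, ← hX, ← hY] at hle3
          have g1 := merge_F2 (x := j) (y := y) (r := r) Y _ hyY hxY rfl
          have g2 := merge_F1 (x := j) (y := y) (r := r) X _ hyX rfl
          refine merge_caseA hr hiX hiY hyX hyY hne (le_antisymm ?_ g2) hY
          have h5 := hle3.trans (mul_le_mul_right g1 (r X))
          exact le_of_mul_le_mul_right h5 (zero_lt_iff.2 (right_ne_zero_of_mul hne))
        · refine ⟨k, by grind, by grind, ?_⟩
          rw [hX, hY]
          refine hle3.trans (mul_le_mul' (merge_F1 _ _ ?_ ?_) (merge_F2 _ _ ?_ ?_ ?_))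
          · grind
          · ext z; grind
          · grind
          · grind
          · ext z; grind
      · refine ⟨j, by grind, by grind, ?_⟩
        rw [hX, hY]
        refine hle.trans (mul_le_mul' (merge_F2 _ _ ?_ ?_ ?_) (merge_F1 _ _ ?_ ?_))
        · grind
        · grind
        · ext z; grind
        · grind
        · rfl
    · rw [hX, hY] at hne ⊢
      by_cases hix : i = x
      · subst hix
        obtain ⟨j, hj, hj', hle⟩ := hr _ Y y (by grind) hyY hne
        refine ⟨j, by grind, by grind, hle.trans (mul_le_mul' (merge_F1 _ _ ?_ ?_) (merge_F2 _ _ ?_ ?_ ?_))⟩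
        · grind
        · ext z; grind
        · grind
        · grind
        · ext z; grind
      · obtain ⟨j, hj, hj', hle⟩ := hr _ Y i (by grind) hiY hne
        refine ⟨j, by grind, by grind, hle.trans (mul_le_mul' (merge_F2 _ _ ?_ ?_ ?_) (merge_F1 _ _ ?_ ?_))⟩
        · grind
        · grind
        · ext z; grind
        · grind
        · rfl
  · -- case B
    have hix : i ≠ x := fun h => hiY (h ▸ hxY)
    rw [hX, hY] at hne ⊢
    obtain ⟨j, hj, hj', hle⟩ := hr _ _ i (by grind) (by grind) hne
    refine ⟨j, by grind, by grind, hle.trans (mul_le_mul' (merge_F2 _ _ ?_ ?_ ?_) (merge_F2 _ _ ?_ ?_ ?_))⟩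
    · grind
    · grind
    · ext z; grind
    · grind
    · grind
    · ext z; grind

end merge

/-- The direct sum of two vectors. -/
def directSumVec (p q : Finset E → S) : Finset (E ⊕ E) → S :=
  fun K => p K.toLeft * q K.toRight

theorem exch_directSum {p q : Finset E → S} (hp : ExchProp p) (hq : ExchProp q) :
    ExchProp (directSumVec p q) := by
  intro X Y i hiX hiY hne
  unfold directSumVec at hne ⊢
  have hpX : p X.toLeft ≠ 0 := fun h => hne (by simp [h])
  have hpY : p Y.toLeft ≠ 0 := fun h => hne (by simp [h])
  have hqX : q X.toRight ≠ 0 := fun h => hne (by simp [h])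
  have hqY : q Y.toRight ≠ 0 := fun h => hne (by simp [h])
  rcases i with a | a
  · obtain ⟨j, hj, hj', hle⟩ := hp X.toLeft Y.toLeft a (by simpa using hiX) (by simpa using hiY)
      (mul_ne_zero hpX hpY)
    refine ⟨Sum.inl j, by simpa using hj, by simpa using hj', ?_⟩
    have e1 : (insert (Sum.inl j) (X.erase (Sum.inl a))).toLeft
        = insert j (X.toLeft.erase a) := by ext z; simp
    have e2 : (insert (Sum.inl a) (Y.erase (Sum.inl j))).toLeft
        = insert a (Y.toLeft.erase j) := by ext z; simp
    have e3 : (insert (Sum.inl j) (X.erase (Sum.inl a))).toRight = X.toRight := by ext z; simp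
    have e4 : (insert (Sum.inl a) (Y.erase (Sum.inl j))).toRight = Y.toRight := by ext z; simp
    rw [e1, e2, e3, e4, mul_mul_mul_comm, mul_mul_mul_comm (p (insert _ _))]
    exact mul_le_mul' hle le_rfl
  · obtain ⟨j, hj, hj', hle⟩ := hq X.toRight Y.toRight a (by simpa using hiX) (by simpa using hiY)
      (mul_ne_zero hqX hqY)
    refine ⟨Sum.inr j, by simpa using hj, by simpa using hj', ?_⟩
    have e1 : (insert (Sum.inr j) (X.erase (Sum.inr a))).toRight
        = insert j (X.toRight.erase a) := by ext z; simp
    have e2 : (insert (Sum.inr a) (Y.erase (Sum.inr j))).toRight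
        = insert a (Y.toRight.erase j) := by ext z; simp
    have e3 : (insert (Sum.inr j) (X.erase (Sum.inr a))).toLeft = X.toLeft := by ext z; simp
    have e4 : (insert (Sum.inr a) (Y.erase (Sum.inr j))).toLeft = Y.toLeft := by ext z; simp
    rw [e1, e2, e3, e4, mul_mul_mul_comm, mul_mul_mul_comm (p X.toLeft) (q (insert _ _))]
    exact mul_le_mul' le_rfl hle

/-- `K` is a lift of `J` when the copies of the elements of `T` are merged. -/
def IsLift (T : Finset E) (K J : Finset (E ⊕ E)) : Prop :=
  ∀ t, (t ∈ T → Sum.inr t ∉ J ∧ ¬ (Sum.inl t ∈ K ∧ Sum.inr t ∈ K) ∧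
      (Sum.inl t ∈ J ↔ (Sum.inl t ∈ K ∨ Sum.inr t ∈ K))) ∧
    (t ∉ T → (Sum.inl t ∈ J ↔ Sum.inl t ∈ K) ∧ (Sum.inr t ∈ J ↔ Sum.inr t ∈ K))

open Classical in
/-- The vector obtained by merging the two copies of all elements of `T`. -/
def partMerge (r : Finset (E ⊕ E) → S) (T : Finset E) : Finset (E ⊕ E) → S :=
  fun J => (Finset.univ.filter fun K => IsLift T K J).sup r

theorem isLift_insert {T : Finset E} {t : E} (ht : t ∉ T) (K J : Finset (E ⊕ E)) :
    IsLift (insert t T) K J ↔ Sum.inr t ∉ J ∧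
      (IsLift T K J ∨
        (Sum.inl t ∈ J ∧ IsLift T K (insert (Sum.inr t) (J.erase (Sum.inl t))))) := by
  constructor
  · intro h
    have h0 := h t
    simp only [Finset.mem_insert, true_or, true_implies, not_true, false_implies, and_true] at h0
    refine ⟨h0.1, ?_⟩
    by_cases hK : Sum.inr t ∈ K
    · right
      refine ⟨by tauto, fun s => ?_⟩
      have hs := h s
      by_cases hst : s = t
      · subst hst
        simp_all
      · simp_all
    · left
      intro s
      have hs := h s
      by_cases hst : s = t
      · subst hst
        simp_all
      · simp_all
  · rintro ⟨h1, h | ⟨h2, h⟩⟩ s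
    · have hs := h s
      by_cases hst : s = t
      · subst hst
        simp_all
      · simp_all
    · have hs := h s
      by_cases hst : s = t
      · subst hst
        simp_all
      · simp_all

theorem partMerge_insert (r : Finset (E ⊕ E) → S) {T : Finset E} {t : E} (ht : t ∉ T) :
    partMerge r (insert t T) = mergeVec (Sum.inl t) (Sum.inr t) (partMerge r T) := by
  classical
  funext J
  unfold mergeVec partMerge
  simp only [isLift_insert ht]
  split_ifs with h1 h2
  · simp only [h1, not_true, false_and, Finset.filter_false, Finset.sup_empty]
    rfl
  · simp only [h1, h2, not_false_eq_true, true_and, Finset.filter_or, Finset.sup_union]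
  · simp only [h1, h2, not_false_eq_true, true_and, false_and, or_false]

theorem partMerge_empty (r : Finset (E ⊕ E) → S) : partMerge r ∅ = r := by
  classical
  funext J
  unfold partMerge
  have : (Finset.univ.filter fun K => IsLift ∅ K J) = {J} := by
    ext K
    rw [Finset.mem_filter, Finset.mem_singleton]
    simp only [Finset.mem_univ, true_and, IsLift]
    constructor
    · intro h
      ext z
      rcases z with z | z
      · have := h z; simp at this; tauto
      · have := h z; simp at this; tauto
    · rintro rfl; simp
  rw [this, Finset.sup_singleton]

theorem exch_partMerge {r : Finset (E ⊕ E) → S} (hr : ExchProp r) (T : Finset E) :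
    ExchProp (partMerge r T) := by
  induction T using Finset.induction_on with
  | empty => rwa [partMerge_empty]
  | insert t T ht ih =>
    rw [partMerge_insert r ht]
    exact exch_merge (by simp) ih

theorem stableSum_eq {d : ℕ} {p q : Finset E → S} (hp : ∀ A, p A ≠ 0 → A.card = d)
    (I : Finset E) :
    stableSum d p q I = partMerge (directSumVec p q) Finset.univ (I.map Function.Embedding.inl) := by
  classical
  unfold stableSum partMerge
  apply le_antisymm
  · refine Finset.sup_le fun A hA => ?_
    simp only [Finset.mem_filter, Finset.mem_powerset] at hA
    refine le_trans (le_of_eq ?_) (Finset.le_sup (b := A.disjSum (I \ A)) ?_)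
    · simp [directSumVec]
    · simp only [Finset.mem_filter, Finset.mem_univ, true_and, IsLift]
      intro t
      have := @hA.1 t
      simp
      tauto
  · refine Finset.sup_le fun K hK => ?_
    simp only [Finset.mem_filter, Finset.mem_univ, true_and, IsLift] at hK
    by_cases h0 : p K.toLeft = 0
    · simp only [directSumVec, h0, zero_mul]; exact zero_le'
    · have e : K.toRight = I \ K.toLeft := by
        ext t
        have := hK t
        simp at this ⊢
        tauto
      unfold directSumVec
      rw [e]
      refine Finset.le_sup (f := fun A => p A * q (I \ A)) ?_
      simp only [Finset.mem_filter, Finset.mem_powerset]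
      refine ⟨fun t ht => ?_, hp _ h0⟩
      have := hK t
      simp at this ht
      tauto

theorem exch_stableSum {d : ℕ} {p q : Finset E → S} (hp : ∀ A, p A ≠ 0 → A.card = d)
    (hp' : ExchProp p) (hq : ExchProp q) : ExchProp (stableSum d p q) := by
  intro X Y i hiX hiY hne
  simp only [stableSum_eq hp] at hne ⊢
  obtain ⟨j, hj, hj', hle⟩ := exch_partMerge (exch_directSum hp' hq) Finset.univ _ _
    (Sum.inl i) (by simpa using hiX) (by simpa using hiY) hne
  rw [Finset.mem_map] at hj
  obtain ⟨k, hk, rfl⟩ := hj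
  refine ⟨k, hk, by simpa using hj', hle.trans (le_of_eq ?_)⟩
  congr 2
  · ext z; rcases z with z | z <;> simp
  · ext z; rcases z with z | z <;> simp

theorem stableSum_supp {d e : ℕ} {p q : Finset E → S}
    (hq : ∀ A, q A ≠ 0 → A.card = e) (I : Finset E) (h : stableSum d p q I ≠ 0) :
    I.card = d + e := by
  by_contra hI
  apply h
  refine le_antisymm (Finset.sup_le fun A hA => ?_) zero_le'
  simp only [Finset.mem_filter, Finset.mem_powerset] at hA
  by_cases h0 : q (I \ A) = 0
  · rw [h0, mul_zero]
  · exfalso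
    have := hq _ h0
    have h2 := Finset.card_sdiff_add_card_eq_card hA.1
    omega

theorem stable_sum_is_plucker {d e : ℕ} (p q : Finset E → S)
    (hp : IsTropPlucker d p) (hq : IsTropPlucker e q)
    (hne : ∃ I, stableSum d p q I ≠ 0) :
    IsTropPlucker (d + e) (stableSum d p q) := by
  exact ⟨hne, stableSum_supp hq.2.1, fun A B _ _ =>
    vanishes_of_exch (exch_stableSum hp.2.1 (exch_of_plucker hp) (exch_of_plucker hq)) A B⟩

end
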